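/- Let G be a simple graph on a finite vertex type V, let ρ, δ : V → ℕ take values in {0, 1}, let G' be the augmented graph of G with respect to (ρ, δ) with new vertices s and t, and suppose the sum over all vertices v of δ(v) equals the sum over all vertices v of ρ(v), with common value k. Then G has a partial orientation realizing (ρ, δ) if and only if G' contains k pairwise edge-disjoint paths from s to t, each of length exactly 3. -/

import Mathlib

/-- A partial orientation of `G` realizing `(ρ, δ)`. -/
def PartialOrientation {V : Type*} (G : SimpleGraph V) (ρ δ : V → ℕ)
    (D : V → V → Prop) : Prop :=
  (∀ u v, D u v → G.Adj u v) ∧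
  (∀ u v, ¬ (D u v ∧ D v u)) ∧
  (∀ v, {w | D v w}.ncard = δ v ∧ {w | D w v}.ncard = ρ v)

/-- The augmented graph of `G` with respect to `(ρ, δ)`: the vertex set is
`V ⊕ Bool`, where `Sum.inr false` is the new vertex `s` and `Sum.inr true` is
the new vertex `t`.  Edges are those of `G`, together with `s ~ v` whenever
`δ v = 1` and `t ~ v` whenever `ρ v = 1`; `s` and `t` are not adjacent. -/
def augGraph {V : Type*} (G : SimpleGraph V) (ρ δ : V → ℕ) :
    SimpleGraph (V ⊕ Bool) :=
  SimpleGraph.fromRel (fun x y =>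
    match x, y with
    | Sum.inl u, Sum.inl v => G.Adj u v
    | Sum.inr false, Sum.inl v => δ v = 1
    | Sum.inr true, Sum.inl v => ρ v = 1
    | _, _ => False)

section AugmentedGraph

variable {V : Type*} {G : SimpleGraph V} {ρ δ : V → ℕ}

theorem augGraph_adj_inl {u v : V} :
    (augGraph G ρ δ).Adj (Sum.inl u) (Sum.inl v) ↔ G.Adj u v := by
  simp only [augGraph, SimpleGraph.fromRel_adj, ne_eq, Sum.inl.injEq]
  exact ⟨fun h => h.2.elim id SimpleGraph.Adj.symm, fun h => ⟨h.ne, Or.inl h⟩⟩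

theorem augGraph_source_adj {x : V ⊕ Bool} :
    (augGraph G ρ δ).Adj (Sum.inr false) x ↔ ∃ v, x = Sum.inl v ∧ δ v = 1 := by
  rcases x with v | _ | _ <;> simp [augGraph]

theorem augGraph_adj_sink {x : V ⊕ Bool} :
    (augGraph G ρ δ).Adj x (Sum.inr true) ↔ ∃ v, x = Sum.inl v ∧ ρ v = 1 := by
  rcases x with v | _ | _ <;> simp [augGraph]

/-- The edges of the walk `s, a, b, t`. -/
abbrev threePathEdges (a b : V) : List (Sym2 (V ⊕ Bool)) :=
  [s(Sum.inr false, Sum.inl a), s(Sum.inl a, Sum.inl b), s(Sum.inl b, Sum.inr true)]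

theorem exists_edges_of_length_eq_three
    (p : (augGraph G ρ δ).Walk (Sum.inr false) (Sum.inr true)) (hp : p.length = 3) :
    ∃ a b : V, δ a = 1 ∧ ρ b = 1 ∧ G.Adj a b ∧ p.edges = threePathEdges a b := by
  cases p with
  | cons h₁ p =>
    cases p with
    | nil => simp at hp
    | cons h₂ p =>
      cases p with
      | nil => simp at hp
      | cons h₃ p =>
        cases p with
        | cons h₄ p => simp at hp
        | nil =>
          obtain ⟨a, rfl, ha⟩ := augGraph_source_adj.1 h₁
          obtain ⟨b, rfl, hb⟩ := augGraph_adj_sink.1 h₃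
          exact ⟨a, b, ha, hb, augGraph_adj_inl.1 h₂, by simp⟩

theorem exists_path_of_adj {a b : V} (ha : δ a = 1) (hb : ρ b = 1) (hab : G.Adj a b) :
    ∃ p : (augGraph G ρ δ).Walk (Sum.inr false) (Sum.inr true),
      (p.IsPath ∧ p.length = 3) ∧ p.edges = threePathEdges a b := by
  refine ⟨.cons (augGraph_source_adj.2 ⟨a, rfl, ha⟩) (.cons (augGraph_adj_inl.2 hab)
    (.cons (augGraph_adj_sink.2 ⟨b, rfl, hb⟩) .nil)), ⟨?_, ?_⟩, ?_⟩ <;>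
  simp [SimpleGraph.Walk.isPath_def, hab.ne]

theorem threePathEdges_disjoint_iff {a b c d : V} :
    (∀ e ∈ threePathEdges a b, e ∉ threePathEdges c d) ↔
      a ≠ c ∧ b ≠ d ∧ ¬ (a = d ∧ b = c) := by
  simp
  tauto

end AugmentedGraph

theorem card_filter_eq_sum {V : Type*} [Fintype V] {g : V → ℕ} (hg : ∀ v, g v ≤ 1) :
    (Finset.univ.filter (g · = 1)).card = ∑ v, g v := by
  rw [Finset.card_filter]
  refine Finset.sum_congr rfl fun v _ => ?_
  have := hg v
  split_ifs <;> omega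

theorem exists_eq_of_injective {V : Type*} [Fintype V] {g : V → ℕ} (hg : ∀ v, g v ≤ 1)
    {f : Fin (∑ v, g v) → V} (hf : f.Injective) (hgf : ∀ i, g (f i) = 1)
    {v : V} (hv : g v = 1) : ∃ i, f i = v := by
  classical
  have h : Finset.univ.image f = Finset.univ.filter (g · = 1) := by
    refine Finset.eq_of_subset_of_card_le (fun w hw => ?_) ?_
    · obtain ⟨i, -, rfl⟩ := Finset.mem_image.1 hw
      simp [hgf]
    · rw [Finset.card_image_of_injective _ hf, card_filter_eq_sum hg, Finset.card_fin]
  have : v ∈ Finset.univ.image f := by simp [h, hv]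
  simpa using this

/-- In the relation pairing `f i` with `f' i`, the fibre over `v` has size `g v`. -/
theorem ncard_fibre {V : Type*} [Fintype V] {g : V → ℕ} (hg : ∀ v, g v ≤ 1) {k : ℕ}
    (hk : k = ∑ v, g v) {f : Fin k → V} (hf : f.Injective) (hgf : ∀ i, g (f i) = 1)
    (f' : Fin k → V) (v : V) : {w | ∃ i, f i = v ∧ f' i = w}.ncard = g v := by
  subst hk
  by_cases hv : g v = 1
  · obtain ⟨i, rfl⟩ := exists_eq_of_injective hg hf hgf hv
    rw [hv, Set.ncard_eq_one]
    refine ⟨f' i, Set.ext fun w => ⟨?_, ?_⟩⟩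
    · rintro ⟨j, hj, rfl⟩
      simp [hf hj]
    · rintro rfl
      exact ⟨i, rfl, rfl⟩
  · have h : {w | ∃ i, f i = v ∧ f' i = w} = ∅ := by
      refine Set.eq_empty_of_forall_notMem ?_
      rintro w ⟨i, rfl, -⟩
      exact hv (hgf i)
    have := hg v
    rw [h, Set.ncard_empty]
    omega

theorem orientation_iff_paths {V : Type*} [Fintype V]
    (G : SimpleGraph V) (ρ δ : V → ℕ)
    (hρ : ∀ v, ρ v ≤ 1) (hδ : ∀ v, δ v ≤ 1)
    (k : ℕ) (hkδ : k = ∑ v, δ v) (hkρ : k = ∑ v, ρ v) :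
    (∃ D : V → V → Prop, PartialOrientation G ρ δ D) ↔
    (∃ P : Fin k → (augGraph G ρ δ).Walk (Sum.inr false) (Sum.inr true),
      (∀ i, (P i).IsPath ∧ (P i).length = 3) ∧
      (∀ i j, i ≠ j → ∀ e, e ∈ (P i).edges → e ∉ (P j).edges)) := by
  constructor
  · rintro ⟨D, hadj, hanti, hcard⟩
    have hout : ∀ v, δ v = 1 → ∃ w, D v w := fun v hv => by
      obtain ⟨w, hw⟩ := Set.ncard_eq_one.1 ((hcard v).1.trans hv)
      exact ⟨w, hw.ge rfl⟩
    have hin : ∀ {u u' w}, D u w → D u' w → u = u' := fun {u u' w} h h' =>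
      (Set.ncard_le_one (Set.toFinite _)).1 ((hcard w).2.trans_le (hρ w)) u h u' h'
    have hin_one : ∀ {u w}, D u w → ρ w = 1 := fun {u w} h => by
      have hpos : 0 < {u | D u w}.ncard := (Set.ncard_pos (Set.toFinite _)).2 ⟨u, h⟩
      have := (hcard w).2
      have := hρ w
      omega
    let e := (Finset.univ.filter (δ · = 1)).equivFinOfCardEq
      ((card_filter_eq_sum hδ).trans hkδ.symm)
    have ha : ∀ i, δ (e.symm i : V) = 1 := fun i => (Finset.mem_filter.1 (e.symm i).2).2
    choose b hb using fun i => hout _ (ha i)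
    choose P hP hedges using fun i =>
      exists_path_of_adj (ha i) (hin_one (hb i)) (hadj _ _ (hb i))
    refine ⟨P, hP, fun i j hij => ?_⟩
    have hne : (e.symm i : V) ≠ e.symm j := fun h => hij (e.symm.injective (Subtype.ext h))
    rw [hedges, hedges, threePathEdges_disjoint_iff]
    refine ⟨hne, fun h => hne (hin (hb i) (h ▸ hb j)), fun ⟨h, h'⟩ => ?_⟩
    exact hanti _ _ ⟨h' ▸ hb i, h ▸ hb j⟩
  · rintro ⟨P, hP, hdisj⟩
    choose a b ha hb hab hedges using fun i => exists_edges_of_length_eq_three (P i) (hP i).2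
    simp only [hedges, threePathEdges_disjoint_iff] at hdisj
    have ha_inj : a.Injective := fun i j h => by_contra fun hij => (hdisj i j hij).1 h
    have hb_inj : b.Injective := fun i j h => by_contra fun hij => (hdisj i j hij).2.1 h
    refine ⟨fun u v => ∃ i, a i = u ∧ b i = v, ?_, ?_, fun v => ⟨?_, ?_⟩⟩
    · rintro _ _ ⟨i, rfl, rfl⟩
      exact hab i
    · rintro _ _ ⟨⟨i, rfl, rfl⟩, j, hj, hj'⟩
      have hij : i ≠ j := by
        rintro rfl
        exact (hab i).ne hj
      exact (hdisj i j hij).2.2 ⟨hj'.symm, hj.symm⟩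
    · exact ncard_fibre hδ hkδ ha_inj ha b v
    · simpa only [and_comm] using ncard_fibre hρ hkρ hb_inj hb a v
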